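/- arXiv:1408.5027 — 2 statements merged into one kernel-verified Lean document; each statement's English description precedes it below -/
import Mathlib

section
/- Let q₀ be a prime power, and let n₀, d₀ be positive integers such that the n₀-dimensional hypercube contains a d₀-equilateral subset of size q₀. Then e_{d₀q₀}(n₀(q₀+1)) ≥ q₀², i.e. the hypercube of dimension n₀(q₀+1) contains a (d₀q₀)-equilateral subset of size q₀². -/
open Filter

/-- A finite subset `S` of the `n`-dimensional hypercube (binary sequences of
length `n`) is `d`-equilateral if it is nonempty and any two distinct points
have Hamming distance exactly `d`. -/
def IsEquilateralSet {n : ℕ} (d : ℕ) (S : Finset (Fin n → Bool)) : Prop :=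
  S.Nonempty ∧ ∀ x ∈ S, ∀ y ∈ S, x ≠ y → hammingDist x y = d

/-- `equilateralDim d n` is the maximal size of a `d`-equilateral subset of the
`n`-dimensional hypercube. -/
noncomputable def equilateralDim (d n : ℕ) : ℕ :=
  sSup {m : ℕ | ∃ S : Finset (Fin n → Bool), IsEquilateralSet d S ∧ S.card = m}

theorem hammingDist_eq_sum {ι β : Type*} [Fintype ι] [DecidableEq β] (x y : ι → β) :
    hammingDist x y = ∑ i, if x i ≠ y i then 1 else 0 :=
  Finset.card_filter _ _

theorem hammingDist_comp_equiv {ι κ β : Type*} [Fintype ι] [Fintype κ] [DecidableEq β]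
    (e : κ ≃ ι) (x y : ι → β) : hammingDist (x ∘ e) (y ∘ e) = hammingDist x y := by
  simp only [hammingDist_eq_sum, Function.comp_apply]
  exact e.sum_comp fun i => if x i ≠ y i then 1 else 0

/-- Concatenating an equidistant inner code with an outer code multiplies distances. -/
theorem hammingDist_concat {ι κ α β : Type*} [Fintype ι] [Fintype κ] [DecidableEq α]
    [DecidableEq β] {d : ℕ} (f : α → ι → β) (hf : ∀ a b, a ≠ b → hammingDist (f a) (f b) = d)
    (x y : κ → α) :
    hammingDist (fun p : ι × κ => f (x p.2) p.1) (fun p => f (y p.2) p.1) =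
      d * hammingDist x y := by
  rw [hammingDist_eq_sum, Fintype.sum_prod_type_right, hammingDist_eq_sum x, Finset.mul_sum]
  refine Finset.sum_congr rfl fun k _ => ?_
  rw [← hammingDist_eq_sum (f (x k)) (f (y k))]
  split_ifs with h
  · rw [hf _ _ h, mul_one]
  · rw [not_not.mp h, hammingDist_self, mul_zero]

/-- The values of the affine function `t ↦ p.1 * t + p.2` on the projective line, where the value
at infinity is the slope. -/
def projectiveLineCode {F : Type*} [Field F] (p : F × F) : Option F → F
  | none => p.1
  | some t => p.1 * t + p.2

theorem hammingDist_projectiveLineCode {F : Type*} [Field F] [Fintype F] [DecidableEq F]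
    {p r : F × F} (h : p ≠ r) :
    hammingDist (projectiveLineCode p) (projectiveLineCode r) = Fintype.card F := by
  obtain ⟨a, b⟩ := p
  obtain ⟨c, d⟩ := r
  suffices ∃ s, ∀ t, projectiveLineCode (a, b) t ≠ projectiveLineCode (c, d) t ↔ t ≠ s by
    obtain ⟨s, hs⟩ := this
    simp only [hammingDist, hs, Finset.filter_ne', Finset.card_erase_of_mem (Finset.mem_univ s),
      Finset.card_univ, Fintype.card_option, Nat.add_sub_cancel]
  by_cases hac : a = c
  · subst hac
    refine ⟨none, ?_⟩
    rintro (_ | t)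
    · simp [projectiveLineCode]
    · simpa [projectiveLineCode] using h
  · have hac' : a - c ≠ 0 := sub_ne_zero.mpr hac
    refine ⟨some ((d - b) / (a - c)), ?_⟩
    rintro (_ | t)
    · simpa [projectiveLineCode] using hac
    · simp only [projectiveLineCode, ne_eq, Option.some.injEq, not_iff_not, eq_div_iff hac']
      constructor <;> intro h <;> linear_combination h

theorem IsEquilateralSet.card_le_equilateralDim {d n : ℕ} {S : Finset (Fin n → Bool)}
    (hS : IsEquilateralSet d S) : S.card ≤ equilateralDim d n := by
  refine le_csSup ⟨Fintype.card (Fin n → Bool), ?_⟩ ⟨S, hS, rfl⟩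
  rintro _ ⟨T, -, rfl⟩
  exact T.card_le_univ

/-- An equidistant family with positive distance is injective, so it bounds `equilateralDim`. -/
theorem card_le_equilateralDim {α : Type*} [Fintype α] [Nonempty α] {d n : ℕ} (hd : 0 < d)
    (f : α → Fin n → Bool) (hf : ∀ a b, a ≠ b → hammingDist (f a) (f b) = d) :
    Fintype.card α ≤ equilateralDim d n := by
  have hinj : Function.Injective f := by
    intro a b hab
    by_contra hne
    have := hf a b hne
    rw [hab, hammingDist_self] at this
    omega
  rw [← Finset.card_univ, ← Finset.card_map ⟨f, hinj⟩]
  refine IsEquilateralSet.card_le_equilateralDim ⟨Finset.univ_nonempty.map, ?_⟩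
  simp only [Finset.mem_map, Finset.mem_univ, true_and, Function.Embedding.coeFn_mk]
  rintro _ ⟨a, rfl⟩ _ ⟨b, rfl⟩ hab
  exact hf a b fun h => hab (congrArg f h)

theorem equilateralDim_prime_power_step (q₀ n₀ d₀ : ℕ) (hq₀ : IsPrimePow q₀)
    (hn₀ : 0 < n₀) (hd₀ : 0 < d₀)
    (h : ∃ S : Finset (Fin n₀ → Bool), IsEquilateralSet d₀ S ∧ S.card = q₀) :
    q₀ ^ 2 ≤ equilateralDim (d₀ * q₀) (n₀ * (q₀ + 1)) := by
  obtain ⟨S, ⟨-, hS⟩, rfl⟩ := h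
  have hcard : Fintype.card S = S.card := Fintype.card_coe S
  obtain ⟨_⟩ : Nonempty (Field S) := Fintype.nonempty_field_iff.mpr (hcard ▸ hq₀)
  let e : Fin (n₀ * (S.card + 1)) ≃ Fin n₀ × Option S :=
    Fintype.equivOfCardEq (by simp)
  let f : S × S → Fin (n₀ * (S.card + 1)) → Bool := fun p =>
    (fun i : Fin n₀ × Option S => (projectiveLineCode p i.2).1 i.1) ∘ e
  have hf : ∀ p r, p ≠ r → hammingDist (f p) (f r) = d₀ * S.card := by
    intro p r hpr
    rw [hammingDist_comp_equiv, hammingDist_concat (fun s : S => s.1)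
      (fun a b hab => hS a a.2 b b.2 (Subtype.coe_injective.ne hab)),
      hammingDist_projectiveLineCode hpr, hcard]
  have := card_le_equilateralDim (Nat.mul_pos hd₀ hq₀.pos) f hf
  rwa [Fintype.card_prod, hcard, ← sq] at this
end

section
/- Define f(α) := limsup_{n→∞} log(e_{⌊n^α⌋}(n))/log(n) for real α ∈ (0,1). Then f(α) ≥ 2/3 for every α ∈ (0,1), and f(1/3) = 2/3; consequently min_{α∈(0,1)} f(α) = 2/3. -/
open Filter

open Finset in
theorem natCast_hammingDist_eq_sum_sq {ι : Type*} [Fintype ι] (x y s : ι → Bool) :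
    (hammingDist x y : ℤ) =
      ∑ i, ((if x i = s i then (0 : ℤ) else 1) - (if y i = s i then (0 : ℤ) else 1)) ^ 2 := by
  rw [hammingDist, card_filter]
  push_cast
  refine sum_congr rfl fun i _ => ?_
  cases x i <;> cases y i <;> cases s i <;> simp

open Finset in
/-- The weighted sum of squared distances in a finite family of vectors. -/
theorem sum_mul_sum_sq_sub {κ ι : Type*} [Fintype κ] [Fintype ι] (a : κ → ι → ℤ) (c : κ → ℤ) :
    ∑ A, ∑ B, c A * c B * ∑ i, (a A i - a B i) ^ 2 =
      2 * (∑ A, c A) * (∑ i, ∑ A, c A * a A i ^ 2) - 2 * ∑ i, (∑ A, c A * a A i) ^ 2 := by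
  have h (i : ι) : ∑ A, ∑ B, c A * c B * (a A i - a B i) ^ 2 =
      2 * (∑ A, c A) * (∑ A, c A * a A i ^ 2) - 2 * (∑ A, c A * a A i) ^ 2 := by
    have e (A B : κ) : c A * c B * (a A i - a B i) ^ 2 =
        (c A * a A i ^ 2) * c B + c A * (c B * a B i ^ 2)
          - 2 * ((c A * a A i) * (c B * a B i)) := by ring
    simp only [e, sum_sub_distrib, sum_add_distrib, ← mul_sum, ← sum_mul]
    ring
  simp only [mul_sum]
  rw [sum_congr rfl fun A _ => sum_comm, sum_comm, ← sum_sub_distrib]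
  refine sum_congr rfl fun i _ => ?_
  rw [h i]
  simp only [mul_sum]

section Equidistant

variable {κ ι : Type*} [Fintype κ] [Fintype ι] [DecidableEq κ] {d : ℤ} {a : κ → ι → ℤ}

open Finset in
theorem sum_mul_of_equidistant
    (hd : ∀ A B, A ≠ B → ∑ i, (a A i - a B i) ^ 2 = d) (c : κ → ℤ) :
    ∑ A, ∑ B, c A * c B * ∑ i, (a A i - a B i) ^ 2 =
      d * ((∑ A, c A) ^ 2 - ∑ A, c A ^ 2) := by
  have h (A B : κ) : c A * c B * ∑ i, (a A i - a B i) ^ 2 =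
      d * (c A * c B) - if A = B then d * (c A * c B) else 0 := by
    split_ifs with hAB
    · subst hAB; simp
    · rw [hd A B hAB]; ring
  simp only [h, sum_sub_distrib, sum_ite_eq, mem_univ, if_true, ← mul_sum, ← sum_mul]
  simp only [sq, mul_sub]

open Finset in
theorem two_mul_column_mul_le_of_equidistant (h01 : ∀ A i, a A i = 0 ∨ a A i = 1)
    (hd : ∀ A B, A ≠ B → ∑ i, (a A i - a B i) ^ 2 = d) (hd0 : 0 ≤ d) (i : ι) :
    2 * ((∑ A, a A i) * (Fintype.card κ - ∑ A, a A i)) ≤ d * Fintype.card κ := by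
  set m : ℤ := ∑ A, a A i with hm
  set N : ℤ := (Fintype.card κ : ℤ) with hN
  have hsq (A : κ) : a A i * a A i = a A i := by rcases h01 A i with h | h <;> simp [h]
  have hcard : ∑ _A : κ, (1 : ℤ) = N := by simp [hN]
  have hN0 : 0 ≤ N := by positivity
  set c : κ → ℤ := fun A => N * a A i - m with hc
  have hsum : ∑ A, c A = 0 := by
    simp only [hc, sum_sub_distrib, ← mul_sum, ← hm, sum_const, card_univ, nsmul_eq_mul, ← hN]
    ring
  have hcol : ∑ A, c A * a A i = m * (N - m) := by
    have e (A : κ) : c A * a A i = (N - m) * a A i := by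
      rw [hc]; linear_combination N * hsq A
    simp only [e, ← mul_sum, ← hm]; ring
  have hc2 : ∑ A, c A ^ 2 = N * (m * (N - m)) := by
    have e (A : κ) : c A ^ 2 = (N ^ 2 - 2 * N * m) * a A i + m ^ 2 * 1 := by
      rw [hc]; linear_combination N ^ 2 * hsq A
    simp only [e, sum_add_distrib, ← mul_sum, ← hm, hcard]; ring
  have key := (sum_mul_of_equidistant hd c).symm.trans (sum_mul_sum_sq_sub a c)
  rw [hsum, hc2] at key
  have hle : (m * (N - m)) ^ 2 ≤ ∑ j, (∑ A, c A * a A j) ^ 2 := by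
    rw [← hcol]
    exact single_le_sum (f := fun j => (∑ A, c A * a A j) ^ 2)
      (fun j _ => sq_nonneg _) (mem_univ i)
  rcases le_or_gt (m * (N - m)) 0 with h0 | h0
  · nlinarith [mul_nonneg hd0 hN0]
  · refine le_of_mul_le_mul_right ?_ h0
    nlinarith

open Finset in
/-- A large equidistant family of zero-one vectors with all columns in the minority is
a family of disjoint sets. -/
theorem equidistant_card_le_or_mul_card_le (h01 : ∀ A i, a A i = 0 ∨ a A i = 1)
    (hd : ∀ A B, A ≠ B → ∑ i, (a A i - a B i) ^ 2 = d) (hd0 : 0 < d)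
    (hmin : ∀ i, 2 * ∑ A, a A i ≤ Fintype.card κ) :
    (Fintype.card κ : ℤ) ≤ 2 * d ^ 2 + 2 * d ∨ d * Fintype.card κ ≤ 2 * Fintype.card ι := by
  by_contra! hcon
  obtain ⟨hbig, hlt⟩ := hcon
  have hcolb := two_mul_column_mul_le_of_equidistant h01 hd hd0.le
  set N : ℤ := (Fintype.card κ : ℤ) with hN
  set n : ℤ := (Fintype.card ι : ℤ) with hn
  have hNpos : 1 < N := by nlinarith
  have hsq (A : κ) (i : ι) : a A i ^ 2 = a A i := by rcases h01 A i with h | h <;> simp [h]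
  have ha0 (A : κ) (i : ι) : 0 ≤ a A i := by rcases h01 A i with h | h <;> simp [h]
  set m : ι → ℤ := fun i => ∑ A, a A i with hm
  set w : κ → ℤ := fun A => ∑ i, a A i with hw
  set W : ℤ := ∑ A, w A with hW
  have hWm : ∑ i, m i = W := by rw [hW, hm, hw]; exact sum_comm
  have hmd (i : ι) : m i ≤ d := by
    have h1 : 2 * (m i * (N - m i)) ≤ d * N := hcolb i
    have h2 : 2 * m i ≤ N := hmin i
    have h3 : 0 ≤ m i := sum_nonneg fun A _ => ha0 A i
    refine le_of_mul_le_mul_right (a := N) ?_ (by linarith)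
    nlinarith
  have htot : d * (N * (N - 1)) = 2 * N * W - 2 * ∑ i, m i ^ 2 := by
    have key := (sum_mul_of_equidistant hd (fun _ => 1)).symm.trans
      (sum_mul_sum_sq_sub a (fun _ => 1))
    simp only [one_mul, one_pow, sum_const, card_univ, nsmul_eq_mul, mul_one, ← hN, hsq] at key
    have hWm' : ∑ i, ∑ A, a A i = W := hWm
    rw [hWm'] at key
    linarith
  have hrow (A : κ) : d * (N - 1) = N * w A + W - 2 * ∑ i, a A i * m i := by
    have h1 : ∑ B, ∑ i, (a A i - a B i) ^ 2 = d * (N - 1) := by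
      have e (B : κ) : ∑ i, (a A i - a B i) ^ 2 = d - if A = B then d else 0 := by
        split_ifs with h
        · subst h; simp
        · rw [hd A B h]; ring
      simp only [e, sum_sub_distrib, sum_ite_eq, mem_univ, if_true, sum_const, card_univ,
        nsmul_eq_mul, ← hN]
      ring
    have h2 (i : ι) : ∑ B, (a A i - a B i) ^ 2 = N * a A i + m i - 2 * (a A i * m i) := by
      have e (B : κ) : (a A i - a B i) ^ 2 = a A i + a B i - 2 * (a A i * a B i) := by
        linear_combination hsq A i + hsq B i
      simp only [e, sum_sub_distrib, sum_add_distrib, sum_const, card_univ, nsmul_eq_mul, ← hN,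
        ← mul_sum, hm]
    rw [← h1, sum_comm]
    simp only [h2, sum_sub_distrib, sum_add_distrib, ← mul_sum, hWm]
    rfl
  have hWlow : d * (N - 1) ≤ 2 * W := by
    refine le_of_mul_le_mul_right (a := N) ?_ (by linarith)
    have : 0 ≤ ∑ i, m i ^ 2 := sum_nonneg fun i _ => sq_nonneg _
    nlinarith
  have hwA (A : κ) : 2 * w A ≤ d := by
    have h1 : ∑ i, a A i * m i ≤ d * w A := by
      rw [hw, mul_sum]
      refine sum_le_sum fun i _ => ?_
      nlinarith [ha0 A i, hmd i]
    have h2 : 2 * (N - 2 * d) * w A ≤ d * (N - 1) := by nlinarith [hrow A]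
    by_contra! hlt'
    have h3 : d + 1 ≤ 2 * w A := hlt'
    have h4 : 0 ≤ N - 2 * d := by nlinarith
    nlinarith [mul_le_mul_of_nonneg_left h3 h4]
  have hWup : 2 * W ≤ d * N := by
    have : ∑ A, 2 * w A ≤ ∑ _A : κ, d := sum_le_sum fun A _ => hwA A
    rw [← mul_sum, sum_const, card_univ, nsmul_eq_mul, ← hN, ← hW] at this
    linarith
  have hm2 : W ≤ ∑ i, m i ^ 2 := by
    rw [← hWm]
    exact sum_le_sum fun i _ => Int.le_self_sq _
  have hWeq : 2 * W = d * N := by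
    refine le_antisymm hWup (le_of_mul_le_mul_right (a := N - 1) ?_ (by linarith))
    nlinarith
  have hcs : (∑ i, m i) ^ 2 ≤ n * ∑ i, m i ^ 2 := by
    have := sq_sum_le_card_mul_sum_sq (s := (univ : Finset ι)) (f := m)
    rwa [card_univ] at this
  rw [hWm] at hcs
  have h2 : 2 * ∑ i, m i ^ 2 = d * N := by
    linear_combination htot + N * hWeq
  have h3 : 0 < d * N := by positivity
  nlinarith

end Equidistant

open Finset in
theorem IsEquilateralSet.card_le {n d : ℕ} (hd : 0 < d) {S : Finset (Fin n → Bool)}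
    (hS : IsEquilateralSet d S) : S.card ≤ 2 * d ^ 2 + 2 * d ∨ d * S.card ≤ 2 * n := by
  classical
  have hmaj (i : Fin n) : ∃ b : Bool,
      2 * ∑ A : S, (if A.1 i = b then (0 : ℤ) else 1) ≤ Fintype.card S := by
    have h : ∑ A : S, (if A.1 i = true then (0 : ℤ) else 1) +
        ∑ A : S, (if A.1 i = false then (0 : ℤ) else 1) = Fintype.card S := by
      rw [← sum_add_distrib]
      have e (A : S) : ((if A.1 i = true then (0 : ℤ) else 1) +
          if A.1 i = false then (0 : ℤ) else 1) = 1 := by cases A.1 i <;> simp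
      simp only [e]
      simp
    by_contra! hb
    have h1 := hb true
    have h2 := hb false
    linarith
  choose s hs using hmaj
  have key := equidistant_card_le_or_mul_card_le (κ := S) (d := (d : ℤ))
    (a := fun A i => if A.1 i = s i then (0 : ℤ) else 1)
    (fun A i => by by_cases h : A.1 i = s i <;> simp [h])
    (fun A B hAB => by
      rw [← natCast_hammingDist_eq_sum_sq A.1 B.1 s,
        hS.2 A.1 A.2 B.1 B.2 (fun h => hAB (Subtype.ext h))])
    (by exact_mod_cast hd) hs
  simp only [Fintype.card_coe, Fintype.card_fin] at key
  exact_mod_cast key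

theorem bddAbove_card_isEquilateralSet (d n : ℕ) :
    BddAbove {m : ℕ | ∃ S : Finset (Fin n → Bool), IsEquilateralSet d S ∧ S.card = m} :=
  ⟨Fintype.card (Fin n → Bool), by rintro _ ⟨S, _, rfl⟩; exact S.card_le_univ⟩

theorem equilateralDim_le_or_mul_le {n d : ℕ} (hd : 0 < d) :
    equilateralDim d n ≤ 2 * d ^ 2 + 2 * d ∨ d * equilateralDim d n ≤ 2 * n := by
  have hne : {m : ℕ | ∃ S : Finset (Fin n → Bool), IsEquilateralSet d S ∧ S.card = m}.Nonempty :=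
    ⟨1, {fun _ => false}, ⟨by simp, by simp +contextual⟩, by simp⟩
  obtain ⟨S, hS, hc⟩ := Nat.sSup_mem hne (bddAbove_card_isEquilateralSet d n)
  rw [equilateralDim, ← hc]
  exact hS.card_le hd

open Finset in
theorem card_le_equilateralDim_s16 {κ ι : Type*} [Fintype κ] [Nonempty κ] [Fintype ι] {d n : ℕ}
    (hd : 0 < d) (hι : Fintype.card ι ≤ n) (v : κ → ι → Bool)
    (hv : ∀ A B, A ≠ B → hammingDist (v A) (v B) = d) :
    Fintype.card κ ≤ equilateralDim d n := by
  classical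
  obtain ⟨e⟩ := Function.Embedding.nonempty_of_card_le (α := ι) (β := Fin n) (by simpa using hι)
  set u : κ → Fin n → Bool := fun A => Function.extend e (v A) (fun _ => false) with hu
  have hdist (A B : κ) (hAB : A ≠ B) : hammingDist (u A) (u B) = d := by
    rw [← hv A B hAB, hammingDist, hammingDist,
      ← card_map e (s := univ.filter fun i => v A i ≠ v B i)]
    congr 1
    ext x
    simp only [mem_filter, mem_univ, true_and, Finset.mem_map, hu]
    constructor
    · intro hx
      by_cases h : ∃ i, e i = x
      · obtain ⟨i, rfl⟩ := h
        rw [e.injective.extend_apply, e.injective.extend_apply] at hx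
        exact ⟨i, hx, rfl⟩
      · rw [Function.extend_apply' _ _ _ h, Function.extend_apply' _ _ _ h] at hx
        exact absurd rfl hx
    · rintro ⟨i, hi, rfl⟩
      rwa [e.injective.extend_apply, e.injective.extend_apply]
  have hinj : Function.Injective u := fun A B h => by
    by_contra hAB
    have := hdist A B hAB
    rw [h, hammingDist_self] at this
    omega
  refine le_csSup (bddAbove_card_isEquilateralSet d n) ⟨univ.image u, ⟨?_, ?_⟩, ?_⟩
  · exact univ_nonempty.image u
  · simp only [mem_image, mem_univ, true_and]
    rintro _ ⟨A, rfl⟩ _ ⟨B, rfl⟩ hne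
    exact hdist A B fun h => hne (h ▸ rfl)
  · rw [card_image_of_injective _ hinj, card_univ]

open Finset in
/-- Repeating `t` times the indicator vectors of the graphs of an equidistant family of
functions gives an equilateral set. -/
theorem card_le_equilateralDim_of_functions {κ O Y : Type*} [Fintype κ] [Nonempty κ] [Fintype O]
    [Fintype Y] [DecidableEq Y] {t h n : ℕ} (hth : 0 < t * h)
    (hn : t * (Fintype.card O * Fintype.card Y) ≤ n) (g : κ → O → Y)
    (hg : ∀ A B, A ≠ B → hammingDist (g A) (g B) = h) :
    Fintype.card κ ≤ equilateralDim (2 * (t * h)) n := by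
  refine card_le_equilateralDim_s16 (ι := Fin t × O × Y) (by omega) (by simpa using hn)
    (fun A x => decide (g A x.2.1 = x.2.2)) fun A B hAB => ?_
  rw [← hg A B hAB, hammingDist, hammingDist, card_filter, card_filter]
  have hrep (F : O → Y → ℕ) :
      ∑ x : Fin t × O × Y, F x.2.1 x.2.2 = t * ∑ o, ∑ y, F o y := by
    simp [Fintype.sum_prod_type]
  refine (hrep fun o y => if decide (g A o = y) ≠ decide (g B o = y) then 1 else 0).trans ?_
  rw [mul_left_comm, Finset.mul_sum _ _ 2]
  congr 1
  refine sum_congr rfl fun o _ => ?_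
  by_cases ho : g A o = g B o
  · simp [ho]
  · have e (y : Y) : (if decide (g A o = y) ≠ decide (g B o = y) then 1 else 0) =
        (if g A o = y then 1 else 0) + if g B o = y then 1 else 0 := by
      by_cases h1 : g A o = y <;> by_cases h2 : g B o = y <;> simp_all
    simp only [e, sum_add_distrib]
    simp [ho]

open Finset in
theorem sq_le_equilateralDim {p t n : ℕ} (hp : p.Prime) (ht : 0 < t)
    (hn : t * ((p + 1) * p) ≤ n) : p ^ 2 ≤ equilateralDim (2 * (t * p)) n := by
  have : Fact p.Prime := ⟨hp⟩
  have := card_le_equilateralDim_of_functions (κ := ZMod p × ZMod p) (O := Option (ZMod p))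
    (Y := ZMod p) (t := t) (h := p) (n := n) (Nat.mul_pos ht hp.pos)
    (by simpa [Fintype.card_option, ZMod.card] using hn)
    (fun A o => o.elim A.2 fun s => A.1 + A.2 * s) ?_
  · simpa [ZMod.card, sq] using this
  rintro ⟨a, b⟩ ⟨a', b'⟩ hAB
  have hex : ∃ o₀ : Option (ZMod p), ∀ o : Option (ZMod p),
      (o.elim b fun s => a + b * s) ≠ (o.elim b' fun s => a' + b' * s) ↔ o ≠ o₀ := by
    by_cases hb : b = b'
    · subst hb
      refine ⟨none, fun o => ?_⟩
      have ha : a ≠ a' := fun h => hAB (by rw [h])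
      cases o <;> simp [ha]
    · refine ⟨some ((a' - a) / (b - b')), fun o => ?_⟩
      have hb' : b - b' ≠ 0 := sub_ne_zero.2 hb
      cases o with
      | none => simp [hb]
      | some s =>
        simp only [Option.elim_some, ne_eq, Option.some.injEq, not_iff_not]
        rw [eq_div_iff hb']
        constructor <;> intro h <;> linear_combination h
  obtain ⟨o₀, ho₀⟩ := hex
  rw [hammingDist]
  simp only [ho₀]
  rw [filter_ne', card_erase_of_mem (mem_univ _), card_univ, Fintype.card_option, ZMod.card]
  rfl

theorem le_equilateralDim_of_mul_le {k N n : ℕ} (hk : 0 < k) (hN : 0 < N) (hn : k * N ≤ n) :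
    N ≤ equilateralDim (2 * k) n := by
  have : Nonempty (Fin N) := ⟨⟨0, hN⟩⟩
  have := card_le_equilateralDim_of_functions (κ := Fin N) (O := Unit) (Y := Fin N)
    (t := k) (h := 1) (n := n) (by simpa using hk) (by simpa using hn) (fun A _ => A)
    (fun A B hAB => by simp [hammingDist, hAB])
  simpa using this

open Finset in
theorem two_pow_le_equilateralDim {M n : ℕ} (hM : 0 < M) (hn : 2 * 2 ^ M ≤ n) :
    2 ^ M ≤ equilateralDim (2 ^ M) n := by
  have h2 : 2 * (1 * 2 ^ (M - 1)) = 2 ^ M := by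
    rw [one_mul, ← pow_succ', Nat.sub_add_cancel hM]
  have := card_le_equilateralDim_of_functions (κ := Fin M → ZMod 2) (O := Fin M → ZMod 2)
    (Y := ZMod 2) (t := 1) (h := 2 ^ (M - 1)) (n := n) (by positivity)
    (by simp [ZMod.card]; omega)
    (fun A x => ∑ i, A i * x i) ?_
  · rw [h2] at this
    simpa [ZMod.card] using this
  intro A B hAB
  obtain ⟨i, hi⟩ := Function.ne_iff.1 hAB
  have hz (a b : ZMod 2) (hab : a ≠ b) : a = b + 1 := by revert a b; decide
  have hflip (x : Fin M → ZMod 2) :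
      ∑ j, A j * (x + Pi.single i 1 : Fin M → ZMod 2) j = ∑ j, B j * (x + Pi.single i 1 : Fin M → ZMod 2) j ↔
        ∑ j, A j * x j ≠ ∑ j, B j * x j := by
    have e (C : Fin M → ZMod 2) :
        ∑ j, C j * (x + Pi.single i 1 : Fin M → ZMod 2) j = ∑ j, C j * x j + C i := by
      simp [mul_add, sum_add_distrib, Pi.single_apply]
    rw [e, e, hz _ _ hi]
    generalize ∑ j, A j * x j = r
    generalize ∑ j, B j * x j = q
    generalize B i = b
    revert r q b
    decide
  have hcard : #{x : Fin M → ZMod 2 | ∑ j, A j * x j ≠ ∑ j, B j * x j} =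
      #{x : Fin M → ZMod 2 | ∑ j, A j * x j = ∑ j, B j * x j} := by
    refine card_equiv (Equiv.addRight (Pi.single i 1)) fun x => ?_
    simp only [mem_filter, mem_univ, true_and, Equiv.coe_addRight]
    exact (hflip x).symm
  have htot := card_filter_add_card_filter_not (s := (univ : Finset (Fin M → ZMod 2)))
    (fun x => ∑ j, A j * x j = ∑ j, B j * x j)
  rw [card_univ, Fintype.card_fun, ZMod.card, Fintype.card_fin] at htot
  change #{x : Fin M → ZMod 2 | ∑ j, A j * x j ≠ ∑ j, B j * x j} = _
  simp only [ne_eq] at hcard ⊢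
  omega

theorem exists_floor_rpow_eq {α : ℝ} (h0 : 0 < α) (h1 : α < 1) (d : ℕ) :
    ∃ n : ℕ, (d : ℝ) ≤ (n : ℝ) ^ α ∧ (n : ℝ) ^ α < d + 1 := by
  have hx : (0 : ℝ) ≤ (d : ℝ) ^ (1 / α) := by positivity
  have hxd : ((d : ℝ) ^ (1 / α)) ^ α = d := by
    rw [← Real.rpow_mul (by positivity), one_div_mul_cancel h0.ne', Real.rpow_one]
  refine ⟨⌈(d : ℝ) ^ (1 / α)⌉₊, ?_, ?_⟩
  · calc (d : ℝ) = ((d : ℝ) ^ (1 / α)) ^ α := hxd.symm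
      _ ≤ _ := Real.rpow_le_rpow hx (Nat.le_ceil _) h0.le
  · calc (⌈(d : ℝ) ^ (1 / α)⌉₊ : ℝ) ^ α < ((d : ℝ) ^ (1 / α) + 1) ^ α :=
          Real.rpow_lt_rpow (by positivity) (Nat.ceil_lt_add_one hx) h0
      _ ≤ ((d : ℝ) ^ (1 / α)) ^ α + 1 ^ α := Real.rpow_add_le_add_rpow hx zero_le_one h0.le h1.le
      _ = d + 1 := by rw [hxd, Real.one_rpow]

theorem eventually_le_mul_log (C : ℝ) {ε : ℝ} (hε : 0 < ε) :
    ∀ᶠ n : ℕ in atTop, C ≤ ε * Real.log n ∧ 0 < Real.log n ∧ 1 < n := by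
  have h : Tendsto (fun n : ℕ => ε * Real.log n) atTop atTop :=
    (Real.tendsto_log_atTop.comp tendsto_natCast_atTop_atTop).const_mul_atTop hε
  filter_upwards [h.eventually_ge_atTop C, eventually_gt_atTop 1] with n h1 h2
  exact ⟨h1, Real.log_pos (by exact_mod_cast h2), h2⟩

theorem eventually_log_div_log_le {e : ℕ → ℕ} {C b : ℝ} (hC : 0 < C) (hb : 0 ≤ b)
    (h : ∀ᶠ n : ℕ in atTop, (e n : ℝ) ≤ C * (n : ℝ) ^ b) {ε : ℝ} (hε : 0 < ε) :
    ∀ᶠ n : ℕ in atTop, Real.log (e n) / Real.log n ≤ b + ε := by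
  filter_upwards [h, eventually_le_mul_log (Real.log C) hε] with n hn ⟨h1, h2, h3⟩
  rw [div_le_iff₀ h2]
  rcases Nat.eq_zero_or_pos (e n) with h0 | h0
  · rw [h0, Nat.cast_zero, Real.log_zero]; positivity
  · have hn0 : (0 : ℝ) < n := by positivity
    calc Real.log (e n) ≤ Real.log (C * (n : ℝ) ^ b) :=
          Real.log_le_log (by exact_mod_cast h0) hn
      _ = Real.log C + b * Real.log n := by
          rw [Real.log_mul hC.ne' (by positivity), Real.log_rpow hn0]
      _ ≤ _ := by linarith

theorem limsup_log_div_log_le {e : ℕ → ℕ} {C b : ℝ} (hC : 0 < C) (hb : 0 ≤ b)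
    (h : ∀ᶠ n : ℕ in atTop, (e n : ℝ) ≤ C * (n : ℝ) ^ b) :
    limsup (fun n : ℕ => Real.log (e n) / Real.log n) atTop ≤ b := by
  refine le_of_forall_pos_le_add fun ε hε => ?_
  refine limsup_le_of_le ?_ (eventually_log_div_log_le hC hb h hε)
  refine IsBoundedUnder.isCoboundedUnder_le ⟨0, ?_⟩
  rw [eventually_map]
  exact Eventually.of_forall fun n =>
    div_nonneg (Real.log_natCast_nonneg _) (Real.log_natCast_nonneg _)

theorem le_limsup_log_div_log {e : ℕ → ℕ} {C C' b b' : ℝ} (hC : 0 < C) (hC' : 0 < C')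
    (hb' : 0 ≤ b') (h' : ∀ᶠ n : ℕ in atTop, (e n : ℝ) ≤ C' * (n : ℝ) ^ b')
    (h : ∃ᶠ n : ℕ in atTop, (n : ℝ) ^ b ≤ C * e n) :
    b ≤ limsup (fun n : ℕ => Real.log (e n) / Real.log n) atTop := by
  refine le_of_forall_pos_sub_le fun ε hε => ?_
  refine le_limsup_of_frequently_le ?_
    ⟨b' + 1, by
      rw [eventually_map]
      exact eventually_log_div_log_le hC' hb' h' one_pos⟩
  refine (h.and_eventually (eventually_le_mul_log (Real.log C) hε)).mono ?_
  rintro n ⟨hn, h1, h2, h3⟩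
  rw [le_div_iff₀ h2]
  have hn0 : (0 : ℝ) < n := by positivity
  have hpos : (0 : ℝ) < (n : ℝ) ^ b := by positivity
  have he : (0 : ℝ) < e n := pos_of_mul_pos_right (hpos.trans_le hn) hC.le
  have := Real.log_le_log hpos hn
  rw [Real.log_rpow hn0, Real.log_mul hC.ne' he.ne'] at this
  linarith

theorem eventually_equilateralDim_le_sq {α : ℝ} (h0 : 0 < α) (h1 : α < 1) :
    ∀ᶠ n : ℕ in atTop, (equilateralDim ⌊(n : ℝ) ^ α⌋₊ n : ℝ) ≤ 6 * (n : ℝ) ^ (2 : ℝ) := by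
  filter_upwards [eventually_ge_atTop 1] with n hn
  have hn' : (1 : ℝ) ≤ n := by exact_mod_cast hn
  have hd0 : 0 < ⌊(n : ℝ) ^ α⌋₊ := Nat.floor_pos.2 (Real.one_le_rpow hn' h0.le)
  have hdn : ⌊(n : ℝ) ^ α⌋₊ ≤ n := by
    refine Nat.floor_le_of_le ?_
    calc (n : ℝ) ^ α ≤ (n : ℝ) ^ (1 : ℝ) := Real.rpow_le_rpow_of_exponent_le hn' h1.le
      _ = n := Real.rpow_one _
  rw [Real.rpow_two]
  generalize ⌊(n : ℝ) ^ α⌋₊ = d at *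
  have : equilateralDim d n ≤ 6 * n ^ 2 := by
    rcases equilateralDim_le_or_mul_le (n := n) hd0 with h | h <;> nlinarith
  exact_mod_cast this

theorem le_limsup_equilateralDim {α b C : ℝ} (h0 : 0 < α) (h1 : α < 1) (hC : 0 < C)
    (h : ∀ K : ℕ, ∃ d : ℕ, K ≤ d ∧ ∀ n : ℕ, d ≤ n → (d : ℝ) ≤ (n : ℝ) ^ α →
      (n : ℝ) ^ α < d + 1 → (n : ℝ) ^ b ≤ C * equilateralDim d n) :
    b ≤ limsup (fun n : ℕ =>
      Real.log (equilateralDim ⌊(n : ℝ) ^ α⌋₊ n) / Real.log n) atTop := by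
  refine le_limsup_log_div_log (e := fun n => equilateralDim ⌊(n : ℝ) ^ α⌋₊ n) hC
    (by norm_num : (0 : ℝ) < 6) (by norm_num) (eventually_equilateralDim_le_sq h0 h1) ?_
  rw [frequently_atTop]
  intro K
  obtain ⟨d, hKd, hd⟩ := h (K + 1)
  obtain ⟨n, hn1, hn2⟩ := exists_floor_rpow_eq h0 h1 d
  have hfl : ⌊(n : ℝ) ^ α⌋₊ = d := (Nat.floor_eq_iff (by positivity)).2 ⟨hn1, hn2⟩
  have hn : 1 ≤ n := by
    rcases Nat.eq_zero_or_pos n with rfl | h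
    · rw [Nat.cast_zero, Real.zero_rpow h0.ne'] at hn1
      have : d ≤ 0 := by exact_mod_cast hn1
      omega
    · exact h
  have hdn : d ≤ n := by
    have : (d : ℝ) ≤ n := hn1.trans <| by
      simpa using Real.rpow_le_rpow_of_exponent_le (by exact_mod_cast hn : (1 : ℝ) ≤ n) h1.le
    exact_mod_cast this
  refine ⟨n, by omega, ?_⟩
  simp only [hfl]
  exact hd n hdn hn1 hn2

theorem le_limsup_equilateralDim_of_le_third {α : ℝ} (h0 : 0 < α) (h1 : α ≤ 1 / 3) :
    2 / 3 ≤ limsup (fun n : ℕ =>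
      Real.log (equilateralDim ⌊(n : ℝ) ^ α⌋₊ n) / Real.log n) atTop := by
  refine le_limsup_equilateralDim (C := 1) h0 (by linarith) one_pos fun K => ?_
  refine ⟨2 * (K + 1), by omega, fun n hdn hn1 _ => ?_⟩
  set k := K + 1 with hk
  have hk0 : 0 < k := by omega
  have hq : 2 ≤ n / k := (Nat.le_div_iff_mul_le hk0).2 hdn
  have he := le_equilateralDim_of_mul_le hk0 (by omega : 0 < n / k) (Nat.mul_div_le n k)
  have hlt : n < 2 * k * (n / k) := by
    have := Nat.lt_mul_div_succ n hk0
    nlinarith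
  have hlt' : (n : ℝ) < (2 * k : ℕ) * equilateralDim (2 * k) n := by
    exact_mod_cast hlt.trans_le (Nat.mul_le_mul_left _ he)
  have hn : (1 : ℝ) ≤ n := by
    have : 1 ≤ n := by omega
    exact_mod_cast this
  have hn0 : (0 : ℝ) < n := by linarith
  have hpos : (0 : ℝ) < (n : ℝ) ^ α := by positivity
  rw [one_mul]
  refine le_of_mul_le_mul_left (a := (n : ℝ) ^ α) ?_ hpos
  calc (n : ℝ) ^ α * (n : ℝ) ^ (2 / 3 : ℝ) = (n : ℝ) ^ (α + 2 / 3) :=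
        (Real.rpow_add hn0 _ _).symm
    _ ≤ (n : ℝ) ^ (1 : ℝ) := Real.rpow_le_rpow_of_exponent_le hn (by linarith)
    _ = n := Real.rpow_one _
    _ ≤ _ := hlt'.le
    _ ≤ _ := by gcongr

theorem le_limsup_equilateralDim_of_mem_Icc {α : ℝ} (h0 : 1 / 3 ≤ α) (h1 : α ≤ 2 / 3) :
    2 / 3 ≤ limsup (fun n : ℕ =>
      Real.log (equilateralDim ⌊(n : ℝ) ^ α⌋₊ n) / Real.log n) atTop := by
  have hα : 0 < α := by linarith
  refine le_limsup_equilateralDim (C := 5 ^ (2 / (3 * α))) hα (by linarith) (by positivity)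
    fun K => ?_
  obtain ⟨p, hKp, hp⟩ := Nat.exists_infinite_primes K
  have hp1 : (1 : ℝ) ≤ p := by exact_mod_cast hp.one_le
  have hp0 : (0 : ℝ) < p := by linarith
  set t := ⌈(p : ℝ) ^ (3 * α - 1)⌉₊ with ht
  have hpow1 : (1 : ℝ) ≤ (p : ℝ) ^ (3 * α - 1) := Real.one_le_rpow hp1 (by linarith)
  have ht0 : 0 < t := Nat.ceil_pos.2 (by linarith)
  have htp : t ≤ p := by
    refine Nat.ceil_le.2 ?_
    simpa using Real.rpow_le_rpow_of_exponent_le hp1 (by linarith : 3 * α - 1 ≤ 1)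
  have hlow : (p : ℝ) ^ (3 * α - 1) ≤ t := Nat.le_ceil _
  have hup : (t : ℝ) < (p : ℝ) ^ (3 * α - 1) + 1 := Nat.ceil_lt_add_one (by linarith)
  have hmul : (p : ℝ) ^ (3 * α - 1) * p = (p : ℝ) ^ (3 * α) := by
    nth_rewrite 2 [← Real.rpow_one (p : ℝ)]
    rw [← Real.rpow_add hp0, sub_add_cancel]
  have hcube : (p : ℝ) ^ (3 * α) = ((p : ℝ) ^ 3) ^ α := by
    rw [Real.rpow_mul hp0.le, ← Real.rpow_natCast]; norm_num
  refine ⟨2 * (t * p), by nlinarith, fun n _ hn1 hn2 => ?_⟩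
  push_cast at hn1 hn2
  have hn : 2 * p ^ 3 ≤ n := by
    have : (2 * (p : ℝ) ^ 3) ≤ n := by
      refine (Real.rpow_le_rpow_iff (by positivity) (by positivity) hα).1 ?_
      calc (2 * (p : ℝ) ^ 3) ^ α = 2 ^ α * (p : ℝ) ^ (3 * α) := by
            rw [Real.mul_rpow (by norm_num) (by positivity), hcube]
        _ ≤ 2 ^ (1 : ℝ) * (t * p) := by
            gcongr
            · norm_num
            · linarith
            · rw [← hmul]; gcongr
        _ ≤ (n : ℝ) ^ α := by rw [Real.rpow_one]; exact hn1
    exact_mod_cast this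
  have hlen : t * ((p + 1) * p) ≤ n := by
    calc t * ((p + 1) * p) ≤ p * ((p + p) * p) := by gcongr; exact hp.one_le
      _ = 2 * p ^ 3 := by ring
      _ ≤ n := hn
  have he := sq_le_equilateralDim hp ht0 hlen
  have h5 : (n : ℝ) ^ α ≤ 5 * (p : ℝ) ^ (3 * α) := by
    have : 1 ≤ (p : ℝ) ^ (3 * α) := Real.one_le_rpow hp1 (by linarith)
    nlinarith
  have hexp : α * (2 / (3 * α)) = 2 / 3 := by field_simp
  calc (n : ℝ) ^ (2 / 3 : ℝ) = ((n : ℝ) ^ α) ^ (2 / (3 * α)) := by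
        rw [← Real.rpow_mul (by positivity), hexp]
    _ ≤ (5 * (p : ℝ) ^ (3 * α)) ^ (2 / (3 * α)) :=
        Real.rpow_le_rpow (by positivity) h5 (by positivity)
    _ = 5 ^ (2 / (3 * α)) * (p : ℝ) ^ 2 := by
        rw [Real.mul_rpow (by norm_num) (by positivity), ← Real.rpow_mul hp0.le,
          show 3 * α * (2 / (3 * α)) = (2 : ℝ) by field_simp, Real.rpow_two]
    _ ≤ _ := by
        gcongr
        exact_mod_cast he

theorem le_limsup_equilateralDim_of_two_thirds_le {α : ℝ} (h0 : 2 / 3 ≤ α) (h1 : α < 1) :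
    2 / 3 ≤ limsup (fun n : ℕ =>
      Real.log (equilateralDim ⌊(n : ℝ) ^ α⌋₊ n) / Real.log n) atTop := by
  have hα : 0 < α := by linarith
  refine le_limsup_equilateralDim (C := 2) hα h1 two_pos fun K => ?_
  obtain ⟨L, hL⟩ := exists_nat_ge (1 / (1 - α))
  set M := max (K + 1) L with hM
  have hKM : K + 1 ≤ M := le_max_left _ _
  have hML : 1 / (1 - α) ≤ M := hL.trans (by exact_mod_cast le_max_right _ _)
  refine ⟨2 ^ M, by have := Nat.lt_two_pow_self (n := M); omega, fun n hdn hn1 hn2 => ?_⟩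
  push_cast at hn1 hn2
  have hlen : 2 * 2 ^ M ≤ n := by
    have : (2 * 2 ^ M : ℝ) ≤ n := by
      refine (Real.rpow_le_rpow_iff (by positivity) (by positivity) hα).1 (le_trans ?_ hn1)
      rw [← pow_succ', ← Real.rpow_natCast, ← Real.rpow_natCast, ← Real.rpow_mul (by norm_num)]
      refine Real.rpow_le_rpow_of_exponent_le (by norm_num) ?_
      rw [div_le_iff₀ (by linarith)] at hML
      push_cast
      nlinarith
    exact_mod_cast this
  have he := two_pow_le_equilateralDim (by omega : 0 < M) hlen
  have he' : (2 : ℝ) ^ M ≤ equilateralDim (2 ^ M) n := by exact_mod_cast he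
  have hd1 : (1 : ℝ) ≤ 2 ^ M := one_le_pow₀ (by norm_num)
  have hn : (1 : ℝ) ≤ n := by
    have : 1 ≤ n := by have := Nat.one_le_two_pow (n := M); omega
    exact_mod_cast this
  calc (n : ℝ) ^ (2 / 3 : ℝ) ≤ (n : ℝ) ^ α := Real.rpow_le_rpow_of_exponent_le hn h0
    _ ≤ 2 * equilateralDim (2 ^ M) n := by linarith

theorem limsup_equilateralDim_third_le :
    limsup (fun n : ℕ =>
      Real.log (equilateralDim ⌊(n : ℝ) ^ (1 / 3 : ℝ)⌋₊ n) / Real.log n) atTop ≤ 2 / 3 := by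
  refine limsup_log_div_log_le (e := fun n => equilateralDim ⌊(n : ℝ) ^ (1 / 3 : ℝ)⌋₊ n)
    (by norm_num : (0 : ℝ) < 4) (by norm_num) ?_
  filter_upwards [eventually_ge_atTop 1] with n hn
  have hn' : (1 : ℝ) ≤ n := by exact_mod_cast hn
  set r : ℝ := (n : ℝ) ^ (1 / 3 : ℝ) with hr
  have hr1 : 1 ≤ r := Real.one_le_rpow hn' (by norm_num)
  have hr2 : (n : ℝ) ^ (2 / 3 : ℝ) = r ^ 2 := by
    rw [hr, ← Real.rpow_natCast, ← Real.rpow_mul (by positivity)]; norm_num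
  have hr3 : (n : ℝ) = r ^ 3 := by
    rw [hr, ← Real.rpow_natCast, ← Real.rpow_mul (by positivity)]; norm_num
  have hd0 : 0 < ⌊r⌋₊ := Nat.floor_pos.2 hr1
  have hdr : (⌊r⌋₊ : ℝ) ≤ r := Nat.floor_le (by linarith)
  have hrd : r < ⌊r⌋₊ + 1 := Nat.lt_floor_add_one r
  rw [hr2]
  generalize ⌊r⌋₊ = d at *
  have hd1 : (1 : ℝ) ≤ d := by exact_mod_cast hd0
  rcases equilateralDim_le_or_mul_le (n := n) hd0 with h | h
  · have h' : (equilateralDim d n : ℝ) ≤ 2 * d ^ 2 + 2 * d := by exact_mod_cast h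
    nlinarith
  · have h' : (d : ℝ) * equilateralDim d n ≤ 2 * n := by exact_mod_cast h
    rw [hr3] at h'
    refine le_of_mul_le_mul_left (a := (d : ℝ)) (h'.trans ?_) (by linarith)
    nlinarith [mul_le_mul_of_nonneg_left (by linarith : r ≤ 2 * d) (sq_nonneg r)]

theorem limsup_equilateralDim_pow_min (f : ℝ → ℝ)
    (hf : ∀ α : ℝ, f α = limsup (fun n : ℕ =>
        Real.log (equilateralDim ⌊(n : ℝ) ^ α⌋₊ n) / Real.log n) atTop) :
    (∀ α : ℝ, 0 < α → α < 1 → 2 / 3 ≤ f α) ∧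
    f (1 / 3) = 2 / 3 ∧
    IsLeast (f '' Set.Ioo (0 : ℝ) 1) (2 / 3) := by
  have hlow : ∀ α : ℝ, 0 < α → α < 1 → 2 / 3 ≤ f α := by
    intro α h0 h1
    rw [hf]
    rcases le_total α (1 / 3) with h | h
    · exact le_limsup_equilateralDim_of_le_third h0 h
    rcases le_total α (2 / 3) with h' | h'
    · exact le_limsup_equilateralDim_of_mem_Icc h h'
    · exact le_limsup_equilateralDim_of_two_thirds_le h' h1
  have hthird : f (1 / 3) = 2 / 3 :=
    le_antisymm (by rw [hf]; exact limsup_equilateralDim_third_le)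
      (hlow _ (by norm_num) (by norm_num))
  refine ⟨hlow, hthird, ⟨1 / 3, by norm_num, hthird⟩, ?_⟩
  rintro _ ⟨α, ⟨h0, h1⟩, rfl⟩
  exact hlow α h0 h1
end
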